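/- Let φ₁, φ₂ : ℝ² → ℝ be smooth with compact support and let ω : ℝ² → ℝ be smooth and bounded with bounded gradient. If −Δφ₂ = rot φ₁ · ∇ω pointwise on ℝ², where rot φ₁ := (∂φ₁/∂x₂, −∂φ₁/∂x₁), then ‖∇φ₂‖_{L²(ℝ²)} ≤ ‖ω‖_{L^∞(ℝ²)} ‖∇φ₁‖_{L²(ℝ²)}. -/

import Mathlib

open MeasureTheory Matrix Set

noncomputable section

/-- The plane `ℝ²` with the Euclidean structure. -/
abbrev E2 := EuclideanSpace ℝ (Fin 2)

/-- Partial derivative `∂ᵢ f` of a scalar function on `ℝ²`. -/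
def pd (i : Fin 2) (f : E2 → ℝ) (x : E2) : ℝ :=
  fderiv ℝ f x (EuclideanSpace.single i 1)

/-- The Laplacian `Δ f = ∂₁∂₁ f + ∂₂∂₂ f`. -/
def lap (f : E2 → ℝ) (x : E2) : ℝ :=
  pd 0 (pd 0 f) x + pd 1 (pd 1 f) x

/-- The rotated gradient `rot ψ = (∂₂ψ, −∂₁ψ)`. -/
def rotv (f : E2 → ℝ) (x : E2) : Fin 2 → ℝ := ![pd 1 f x, -(pd 0 f x)]

/-- The gradient `∇f = (∂₁f, ∂₂f)` as a plain vector. -/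
def grad2 (f : E2 → ℝ) (x : E2) : Fin 2 → ℝ := ![pd 0 f x, pd 1 f x]

/-- The Jacobian matrix `(∇u)ᵢⱼ = ∂ⱼ uᵢ` of a vector field. -/
def gradMat (u : E2 → Fin 2 → ℝ) (x : E2) : Matrix (Fin 2) (Fin 2) ℝ :=
  Matrix.of fun i j => pd j (fun y => u y i) x

/-- The divergence `∇·u = ∂₁u₁ + ∂₂u₂` of a vector field. -/
def divg (u : E2 → Fin 2 → ℝ) (x : E2) : ℝ :=
  pd 0 (fun y => u y 0) x + pd 1 (fun y => u y 1) x

theorem contDiff_pd {f : E2 → ℝ} (hf : ContDiff ℝ (⊤ : ℕ∞) f) (i : Fin 2) :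
    ContDiff ℝ (⊤ : ℕ∞) (pd i f) :=
  (hf.fderiv_right (m := (⊤ : ℕ∞)) (by simp)).clm_apply contDiff_const

theorem hasCompactSupport_pd {f : E2 → ℝ} (hf : HasCompactSupport f) (i : Fin 2) :
    HasCompactSupport (pd i f) :=
  hf.fderiv_apply ℝ (EuclideanSpace.single i 1)

theorem pd_add {f g : E2 → ℝ} (hf : Differentiable ℝ f) (hg : Differentiable ℝ g)
    (i : Fin 2) (x : E2) : pd i (fun y => f y + g y) x = pd i f x + pd i g x := by
  simp only [pd, fderiv_fun_add (hf x) (hg x), _root_.add_apply]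

theorem pd_sub {f g : E2 → ℝ} (hf : Differentiable ℝ f) (hg : Differentiable ℝ g)
    (i : Fin 2) (x : E2) : pd i (fun y => f y - g y) x = pd i f x - pd i g x := by
  simp only [pd, fderiv_fun_sub (hf x) (hg x), _root_.sub_apply]

theorem pd_mul {f g : E2 → ℝ} (hf : Differentiable ℝ f) (hg : Differentiable ℝ g)
    (i : Fin 2) (x : E2) : pd i (fun y => f y * g y) x = f x * pd i g x + g x * pd i f x := by
  simp only [pd, fderiv_fun_mul (hf x) (hg x), _root_.add_apply,
    _root_.smul_apply, smul_eq_mul]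

theorem pd_comm {f : E2 → ℝ} (hf : ContDiff ℝ (⊤ : ℕ∞) f) (i j : Fin 2) (x : E2) :
    pd i (pd j f) x = pd j (pd i f) x := by
  have hd : DifferentiableAt ℝ (fderiv ℝ f) x :=
    (hf.fderiv_right (m := (⊤ : ℕ∞)) (by simp)).differentiable (by simp) x
  have key (k l : Fin 2) : pd k (pd l f) x =
      fderiv ℝ (fderiv ℝ f) x (EuclideanSpace.single k 1) (EuclideanSpace.single l 1) := by
    change fderiv ℝ (fun y => fderiv ℝ f y (EuclideanSpace.single l 1)) x _ = _
    rw [fderiv_clm_apply hd (differentiableAt_const _)]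
    simp
  rw [key, key]
  exact (hf.contDiffAt.isSymmSndFDerivAt (by
    rw [minSmoothness_of_isRCLikeNormedField]
    exact WithTop.coe_le_coe.2 (le_top : (2 : ℕ∞) ≤ ⊤))) _ _

theorem integral_pd_eq_zero {f : E2 → ℝ} (hf : ContDiff ℝ (⊤ : ℕ∞) f)
    (hfs : HasCompactSupport f) (i : Fin 2) : ∫ x, pd i f x = 0 := by
  have hi : Integrable f := hf.continuous.integrable_of_hasCompactSupport hfs
  have hi' : Integrable (pd i f) :=
    (contDiff_pd hf i).continuous.integrable_of_hasCompactSupport (hasCompactSupport_pd hfs i)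
  have h := integral_mul_fderiv_eq_neg_fderiv_mul_of_integrable (𝕜 := ℝ) (μ := (volume : Measure E2))
    (f := fun _ => (1 : ℝ)) (g := f) (v := EuclideanSpace.single i 1)
    (by simp) (by simp only [one_mul]; exact hi') (by simpa only [one_mul] using hi)
    (fun _ _ => differentiableAt_const _) (fun x _ => hf.differentiable (by simp) x)
  simpa [pd] using h

theorem integrable_gradSq {f : E2 → ℝ} (hf : ContDiff ℝ (⊤ : ℕ∞) f)
    (hfs : HasCompactSupport f) : Integrable fun x : E2 => pd 0 f x ^ 2 + pd 1 f x ^ 2 := by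
  have h (i : Fin 2) : Integrable fun x : E2 => pd i f x ^ 2 := by
    simp only [pow_two]
    exact ((contDiff_pd hf i).continuous.mul
      (contDiff_pd hf i).continuous).integrable_of_hasCompactSupport
        (hasCompactSupport_pd hfs i).mul_right
  exact (h 0).add (h 1)

/-- the bound `‖∇φ₂‖_{L²} ≤ ‖ω‖_{L^∞} ‖∇φ₁‖_{L²}` for the solution of
`−Δφ₂ = rot φ₁ · ∇ω`. -/
theorem phi2_gradient_bound
    (φ₁ φ₂ : E2 → ℝ)
    (hφ₁ : ContDiff ℝ (⊤ : ℕ∞) φ₁) (hφ₁s : HasCompactSupport φ₁)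
    (hφ₂ : ContDiff ℝ (⊤ : ℕ∞) φ₂) (hφ₂s : HasCompactSupport φ₂)
    (ω : E2 → ℝ) (hω : ContDiff ℝ (⊤ : ℕ∞) ω)
    (hωb : ∃ C, ∀ x : E2, |ω x| ≤ C)
    (hωg : ∃ C, ∀ (x : E2) (i : Fin 2), |pd i ω x| ≤ C)
    (heq : ∀ x : E2, -(lap φ₂ x) = rotv φ₁ x ⬝ᵥ grad2 ω x) :
    Real.sqrt (∫ x : E2, ((pd 0 φ₂ x) ^ 2 + (pd 1 φ₂ x) ^ 2))
      ≤ (⨆ x : E2, |ω x|) * Real.sqrt (∫ x : E2, ((pd 0 φ₁ x) ^ 2 + (pd 1 φ₁ x) ^ 2)) := by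
  obtain ⟨C, hC⟩ := hωb
  have hM (x : E2) : |ω x| ≤ ⨆ x : E2, |ω x| :=
    le_ciSup (f := fun x : E2 => |ω x|) ⟨C, by rintro _ ⟨y, rfl⟩; exact hC y⟩ x
  set M := ⨆ x : E2, |ω x|
  have hM0 : 0 ≤ M := (abs_nonneg _).trans (hM 0)
  have hd {f : E2 → ℝ} (hf : ContDiff ℝ (⊤ : ℕ∞) f) : Differentiable ℝ f :=
    hf.differentiable (by simp)
  let F : E2 → ℝ := fun x => φ₂ x * (pd 0 φ₂ x + ω x * pd 1 φ₁ x)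
  let G : E2 → ℝ := fun x => φ₂ x * (pd 1 φ₂ x - ω x * pd 0 φ₁ x)
  have hF : ContDiff ℝ (⊤ : ℕ∞) F :=
    hφ₂.mul ((contDiff_pd hφ₂ 0).add (hω.mul (contDiff_pd hφ₁ 1)))
  have hG : ContDiff ℝ (⊤ : ℕ∞) G :=
    hφ₂.mul ((contDiff_pd hφ₂ 1).sub (hω.mul (contDiff_pd hφ₁ 0)))
  have hFs : HasCompactSupport F := hφ₂s.mul_right
  have hGs : HasCompactSupport G := hφ₂s.mul_right
  have hdiv (x : E2) : pd 0 F x + pd 1 G x = (pd 0 φ₂ x ^ 2 + pd 1 φ₂ x ^ 2)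
      + ω x * (pd 0 φ₂ x * pd 1 φ₁ x - pd 1 φ₂ x * pd 0 φ₁ x) := by
    have hω₁ (i : Fin 2) := hω.mul (contDiff_pd hφ₁ i)
    have e := heq x
    simp only [lap, rotv, grad2, dotProduct, Fin.sum_univ_two, Matrix.cons_val_zero,
      Matrix.cons_val_one] at e
    rw [pd_mul (hd hφ₂) (hd ((contDiff_pd hφ₂ 0).add (hω₁ 1))),
      pd_mul (hd hφ₂) (hd ((contDiff_pd hφ₂ 1).sub (hω₁ 0))),
      pd_add (hd (contDiff_pd hφ₂ 0)) (hd (hω₁ 1)),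
      pd_sub (hd (contDiff_pd hφ₂ 1)) (hd (hω₁ 0)),
      pd_mul (hd hω) (hd (contDiff_pd hφ₁ 1)), pd_mul (hd hω) (hd (contDiff_pd hφ₁ 0)),
      pd_comm hφ₁ 1 0]
    linear_combination -φ₂ x * e
  have hFi : Integrable (pd 0 F) :=
    (contDiff_pd hF 0).continuous.integrable_of_hasCompactSupport (hasCompactSupport_pd hFs 0)
  have hGi : Integrable (pd 1 G) :=
    (contDiff_pd hG 1).continuous.integrable_of_hasCompactSupport (hasCompactSupport_pd hGs 1)
  have hI₁ := integrable_gradSq hφ₁ hφ₁s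
  have hdivi : Integrable fun x => pd 0 F x + pd 1 G x := hFi.add hGi
  have hzero : ∫ x, (pd 0 F x + pd 1 G x) = 0 := by
    rw [integral_add hFi hGi, integral_pd_eq_zero hF hFs, integral_pd_eq_zero hG hGs, add_zero]
  have hle : ∫ x, (pd 0 φ₂ x ^ 2 + pd 1 φ₂ x ^ 2)
      ≤ ∫ x, (2 * (pd 0 F x + pd 1 G x) + M ^ 2 * (pd 0 φ₁ x ^ 2 + pd 1 φ₁ x ^ 2)) := by
    refine integral_mono (integrable_gradSq hφ₂ hφ₂s)
      ((hdivi.const_mul 2).add (hI₁.const_mul (M ^ 2))) fun x => ?_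
    have hsq : ω x ^ 2 ≤ M ^ 2 := sq_le_sq' (abs_le.mp (hM x)).1 (abs_le.mp (hM x)).2
    have hmul := mul_le_mul_of_nonneg_right hsq
      (add_nonneg (sq_nonneg (pd 0 φ₁ x)) (sq_nonneg (pd 1 φ₁ x)))
    change _ ≤ 2 * (pd 0 F x + pd 1 G x) + M ^ 2 * (pd 0 φ₁ x ^ 2 + pd 1 φ₁ x ^ 2)
    rw [hdiv]
    linarith [sq_nonneg (pd 0 φ₂ x + ω x * pd 1 φ₁ x),
      sq_nonneg (pd 1 φ₂ x - ω x * pd 0 φ₁ x)]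
  rw [integral_add (hdivi.const_mul 2) (hI₁.const_mul (M ^ 2)), integral_const_mul,
    integral_const_mul, hzero, mul_zero, zero_add] at hle
  calc _ ≤ √(M ^ 2 * ∫ x : E2, (pd 0 φ₁ x ^ 2 + pd 1 φ₁ x ^ 2)) := Real.sqrt_le_sqrt hle
    _ = _ := by rw [Real.sqrt_mul (sq_nonneg M), Real.sqrt_sq hM0]
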